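/- arXiv:0901.2838 — 2 statements merged into one kernel-verified Lean document; each statement's English description precedes it below -/
import Mathlib

section
/- The function B(y) = ((b−1)/b)·G_d(y)²·( (b−1)·ε·ε̃/y² − (ε−ε̃)·x/y + x² ) + 2·G_d(y)·( (b−1)·ε·ε̃/y + ε̃·x ) + d·x^d − d·x^(2d) + b·ε·ε̃ is differentiable on (0, ∞) and satisfies, for all y > 0, dB/dy = ((b−1)/y)·( 2d·B(y) + d·( ( ē_{r_d}(y) − ē_l(y) )/ē_l(y) )·( d·ē_{r_d}(y) + 2·A(y) ) ), where A(y) = G_d(y)·( (b−1)·ε·ε̃/y + ε̃·x ) + b·ε·ε̃ and ē_{r_d}(y) = x^d. -/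
open Finset Filter

/-- `x(y) = ε·y^(b−1)`. -/
noncomputable def xx (b : ℕ) (ε y : ℝ) : ℝ := ε * y ^ (b - 1)

/-- `G_j(y) = C(d−1,j−1)·x^(j−1)·x̃^(d−j−1)·(d·x − j) + 1_{j=1}` for `j ∈ {1,…,d−1}`. -/
noncomputable def G (b d : ℕ) (ε : ℝ) (j : ℕ) (y : ℝ) : ℝ :=
  (Nat.choose (d - 1) (j - 1) : ℝ) * xx b ε y ^ (j - 1) *
      (1 - xx b ε y) ^ (d - j - 1) * ((d : ℝ) * xx b ε y - (j : ℝ)) +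
    (if j = 1 then (1 : ℝ) else 0)

/-- `G_d(y) = −d·x^(d−1)`. -/
noncomputable def Gd (b d : ℕ) (ε y : ℝ) : ℝ := -(d : ℝ) * xx b ε y ^ (d - 1)

/-- `ē_l(y) = x·y`. -/
noncomputable def el (b : ℕ) (ε y : ℝ) : ℝ := xx b ε y * y

/-- `ē_{r_1}(y) = x·(y − 1 + x̃^(d−1))` and `ē_{r_j}(y) = C(d−1,j−1)·x^j·x̃^(d−j)` for `j ≥ 2`. -/
noncomputable def er (b d : ℕ) (ε : ℝ) (j : ℕ) (y : ℝ) : ℝ :=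
  if j = 1 then xx b ε y * (y - 1 + (1 - xx b ε y) ^ (d - 1))
  else (Nat.choose (d - 1) (j - 1) : ℝ) * xx b ε y ^ j * (1 - xx b ε y) ^ (d - j)

/-- `A(y) = G_d(y)·((b−1)·ε·ε̃/y + ε̃·x) + b·ε·ε̃`. -/
noncomputable def Afun (b d : ℕ) (ε y : ℝ) : ℝ :=
  Gd b d ε y * (((b : ℝ) - 1) * ε * (1 - ε) / y + (1 - ε) * xx b ε y) + (b : ℝ) * ε * (1 - ε)

/-- `B(y) = ((b−1)/b)·G_d(y)²·((b−1)·ε·ε̃/y² − (ε−ε̃)·x/y + x²)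
  + 2·G_d(y)·((b−1)·ε·ε̃/y + ε̃·x) + d·x^d − d·x^(2d) + b·ε·ε̃`. -/
noncomputable def Bfun (b d : ℕ) (ε y : ℝ) : ℝ :=
  (((b : ℝ) - 1) / (b : ℝ)) * Gd b d ε y ^ 2 *
      (((b : ℝ) - 1) * ε * (1 - ε) / y ^ 2 - (ε - (1 - ε)) * xx b ε y / y + xx b ε y ^ 2) +
    2 * Gd b d ε y * (((b : ℝ) - 1) * ε * (1 - ε) / y + (1 - ε) * xx b ε y) +
    (d : ℝ) * xx b ε y ^ d - (d : ℝ) * xx b ε y ^ (2 * d) + (b : ℝ) * ε * (1 - ε)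

/-- `x(y)` has logarithmic derivative `(b − 1)/y`. -/
theorem hasDerivAt_xx {b : ℕ} (hb : 1 ≤ b) (ε : ℝ) {y : ℝ} (hy : y ≠ 0) :
    HasDerivAt (xx b ε) (((b : ℝ) - 1) * xx b ε y / y) y := by
  obtain ⟨m, rfl⟩ := Nat.exists_eq_add_of_le' hb
  unfold xx
  refine ((hasDerivAt_pow (m + 1 - 1) y).const_mul ε).congr_deriv ?_
  cases m with
  | zero => simp
  | succ m =>
    simp only [Nat.add_sub_cancel]
    push_cast
    field_simp
    ring

/-- `x(y)ⁿ` has logarithmic derivative `n(b − 1)/y`. -/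
theorem hasDerivAt_xx_pow {b : ℕ} (hb : 1 ≤ b) (ε : ℝ) {y : ℝ} (hy : y ≠ 0) (n : ℕ) :
    HasDerivAt (fun z => xx b ε z ^ n) ((n : ℝ) * ((b : ℝ) - 1) * xx b ε y ^ n / y) y := by
  refine ((hasDerivAt_xx hb ε hy).fun_pow n).congr_deriv ?_
  cases n with
  | zero => simp
  | succ n =>
    simp only [Nat.add_sub_cancel]
    ring

/-- `G_d(y)` has logarithmic derivative `(d − 1)(b − 1)/y`. -/
theorem hasDerivAt_Gd {b d : ℕ} (hb : 1 ≤ b) (hd : 1 ≤ d) (ε : ℝ) {y : ℝ} (hy : y ≠ 0) :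
    HasDerivAt (Gd b d ε) (((d : ℝ) - 1) * ((b : ℝ) - 1) * Gd b d ε y / y) y := by
  unfold Gd
  refine ((hasDerivAt_xx_pow hb ε hy (d - 1)).const_mul (-(d : ℝ))).congr_deriv ?_
  rw [Nat.cast_sub hd]
  push_cast
  ring

/-- `B` is differentiable on `(0,∞)` and satisfies
`dB/dy = ((b−1)/y)·(2d·B(y) + d·((ē_{r_d}(y) − ē_l(y))/ē_l(y))·(d·ē_{r_d}(y) + 2·A(y)))`,
where `ē_{r_d}(y) = x^d`. -/
theorem B_hasDerivAt (b d : ℕ) (hb : 2 ≤ b) (hd : 2 ≤ d) (ε : ℝ)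
    (hε0 : 0 < ε) (hε1 : ε < 1) :
    ∀ y : ℝ, 0 < y →
      HasDerivAt (Bfun b d ε)
        ((((b : ℝ) - 1) / y) *
          (2 * (d : ℝ) * Bfun b d ε y +
            (d : ℝ) * ((xx b ε y ^ d - el b ε y) / el b ε y) *
              ((d : ℝ) * xx b ε y ^ d + 2 * Afun b d ε y))) y := by 
  intro y hy
  have hy0 : y ≠ 0 := hy.ne'
  have hb1 : 1 ≤ b := by omega
  have hd1 : 1 ≤ d := by omega
  have hb0 : (b : ℝ) ≠ 0 := by positivity
  have hx0 : xx b ε y ≠ 0 := (mul_pos hε0 (pow_pos hy _)).ne'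
  have hX := hasDerivAt_xx hb1 ε hy0
  have hG := hasDerivAt_Gd hb1 hd1 ε hy0
  have hY := hasDerivAt_id' y
  have hc (c : ℝ) := hasDerivAt_const y c
  have hquad := (((hc (((b : ℝ) - 1) * ε * (1 - ε))).fun_div (hY.fun_pow 2)
    (pow_ne_zero 2 hy0)).fun_sub ((hX.const_mul (ε - (1 - ε))).fun_div hY hy0)).fun_add
    (hX.fun_pow 2)
  have hlin := ((hc (((b : ℝ) - 1) * ε * (1 - ε))).fun_div hY hy0).fun_add
    (hX.const_mul (1 - ε))
  have hB := (((((hG.fun_pow 2).const_mul (((b : ℝ) - 1) / (b : ℝ))).fun_mul hquad).fun_add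
    ((hG.const_mul 2).fun_mul hlin)).fun_add
    ((hasDerivAt_xx_pow hb1 ε hy0 d).const_mul (d : ℝ))).fun_sub
    ((hasDerivAt_xx_pow hb1 ε hy0 (2 * d)).const_mul (d : ℝ))
  refine (hB.add_const ((b : ℝ) * ε * (1 - ε))).congr_deriv ?_
  obtain ⟨k, rfl⟩ := Nat.exists_eq_add_of_le' hd1
  simp only [Bfun, Afun, Gd, el, Nat.add_sub_cancel, pow_mul', pow_succ (xx b ε y) k]
  generalize xx b ε y ^ k = p
  generalize xx b ε y = x at hx0 ⊢
  push_cast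
  field_simp
  ring
end

section
/- For all y > 0, the sum Σ_{k=1}^{d−1} δ_{r_1,r_k}(y) equals −((b−1)/b)·G_d(y)·G_1(y)·( (b−1)·ε·ε̃/y² − (ε−ε̃)·x/y + x² ) − G_1(y)·( (b−1)·ε·ε̃/y + ε̃·x ) + d·x^(d+1)·x̃^(d−1) + G_d(y)·( (b−1)·ε·ε̃/y + ε̃·x ) + d·x^d·x̃ + b·ε·ε̃. -/
open Finset Filter

/-- `δ_{r_k,r_j}(y)` as in Theorem 1. -/
noncomputable def drr (b d : ℕ) (ε : ℝ) (k j : ℕ) (y : ℝ) : ℝ :=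
  (((b : ℝ) - 1) / (b : ℝ)) * G b d ε k y * G b d ε j y *
      (ε * (1 - ε) * ((b : ℝ) - 1) / y ^ 2 - (ε - (1 - ε)) * xx b ε y / y + xx b ε y ^ 2)
    - (d : ℝ) * (Nat.choose (d - 1) (k - 1) : ℝ) * (Nat.choose (d - 1) (j - 1) : ℝ) *
        xx b ε y ^ (k + j) * (1 - xx b ε y) ^ (2 * d - k - j)
    + (if k = j then (1 : ℝ) else 0) * (k : ℝ) * (Nat.choose (d - 1) (k - 1) : ℝ) *
        xx b ε y ^ k * (1 - xx b ε y) ^ (d - k)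
    + (if k = 1 ∧ j = 1 then (1 : ℝ) else 0) *
        ((b : ℝ) * ε * (1 - ε) - xx b ε y * (1 - xx b ε y))
    - ((if k = 1 then (1 : ℝ) else 0) * G b d ε j y +
        (if j = 1 then (1 : ℝ) else 0) * G b d ε k y) *
        (ε * (1 - ε) * ((b : ℝ) - 1) / y - ε * xx b ε y + xx b ε y ^ 2)

/-- The binomial expansion of `(x + (1 - x)) ^ n` without its top term. -/
lemma sum_range_choose_mul_pow (n : ℕ) (x : ℝ) :
    ∑ i ∈ range n, (n.choose i : ℝ) * x ^ i * (1 - x) ^ (n - i) = 1 - x ^ n := by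
  have h := add_pow x (1 - x) n
  rw [sum_range_succ, add_sub_cancel, one_pow] at h
  simp only [Nat.sub_self, pow_zero, Nat.choose_self, Nat.cast_one, mul_one] at h
  rw [eq_sub_iff_add_eq, sum_congr rfl fun i _ => mul_rotate _ _ _]
  exact h.symm

lemma sum_range_choose_mul_pow_mul_sub (n : ℕ) (x : ℝ) :
    ∑ i ∈ range n, (n.choose i : ℝ) * x ^ i * (1 - x) ^ (n - 1 - i) * (n * x - i) =
      n * x ^ n := by
  have h := sum_range_sub (fun i : ℕ => (i : ℝ) * n.choose i * x ^ i * (1 - x) ^ (n - i)) n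
  simp only [Nat.choose_self, Nat.sub_self, pow_zero, Nat.cast_zero, Nat.cast_one, mul_one,
    zero_mul, sub_zero] at h
  rw [← h]
  refine sum_congr rfl fun i hi => ?_
  have hin : i < n := mem_range.mp hi
  have hc : (n.choose (i + 1) : ℝ) * (i + 1) = n.choose i * (n - i) := by
    have := Nat.choose_succ_right_eq n i
    rw [← Nat.cast_sub hin.le]
    exact_mod_cast this
  rw [show n - (i + 1) = n - 1 - i by omega, show n - i = n - 1 - i + 1 by omega]
  push_cast
  linear_combination (-(x ^ (i + 1) * (1 - x) ^ (n - 1 - i))) * hc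

lemma sum_G (b d : ℕ) (hd : 2 ≤ d) (ε y : ℝ) :
    ∑ k ∈ Icc 1 (d - 1), G b d ε k y = -Gd b d ε y := by
  obtain ⟨m, rfl⟩ := Nat.exists_eq_add_of_le' hd
  simp only [G, Gd, sum_add_distrib, sum_ite_eq', mem_Icc]
  generalize xx b ε y = x
  rw [← Finset.Ico_add_one_right_eq_Icc, sum_Ico_eq_sum_range]
  have h1 := sum_range_choose_mul_pow (m + 1) x
  have h2 := sum_range_choose_mul_pow_mul_sub (m + 1) x
  have h3 : ∑ i ∈ range (m + 1), ((m + 1).choose i : ℝ) * x ^ i * (1 - x) ^ (m - i) *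
      ((m + 2 : ℝ) * x - (i + 1)) = (m + 1) * x ^ (m + 1) - (1 - x ^ (m + 1)) := by
    rw [← h1]
    push_cast at h2
    rw [← h2, ← sum_sub_distrib]
    refine sum_congr rfl fun i hi => ?_
    rw [show m + 1 - i = m - i + 1 by have := mem_range.mp hi; omega]
    ring
  have h4 : ∀ i, m + 2 - (1 + i) - 1 = m - i := fun i => by omega
  simp only [show m + 2 - 1 = m + 1 by omega, Nat.add_sub_cancel, Nat.add_sub_cancel_left, h4]
  push_cast
  simp only [add_comm (1 : ℝ)]
  rw [h3, if_pos (by simp)]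
  ring

/-- For all `y > 0`, `Σ_{k=1}^{d−1} δ_{r_1,r_k}(y)
  = −((b−1)/b)·G_d(y)·G_1(y)·((b−1)·ε·ε̃/y² − (ε−ε̃)·x/y + x²)
    − G_1(y)·((b−1)·ε·ε̃/y + ε̃·x) + d·x^(d+1)·x̃^(d−1)
    + G_d(y)·((b−1)·ε·ε̃/y + ε̃·x) + d·x^d·x̃ + b·ε·ε̃`. -/
theorem sum_drr_row_one (b d : ℕ) (hb : 2 ≤ b) (hd : 2 ≤ d) (ε : ℝ)
    (hε0 : 0 < ε) (hε1 : ε < 1) (y : ℝ) (hy : 0 < y) :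
    ∑ k ∈ Finset.Icc 1 (d - 1), drr b d ε 1 k y =
      -((((b : ℝ) - 1) / (b : ℝ)) * Gd b d ε y * G b d ε 1 y *
          (((b : ℝ) - 1) * ε * (1 - ε) / y ^ 2 - (ε - (1 - ε)) * xx b ε y / y +
            xx b ε y ^ 2)) -
        G b d ε 1 y * (((b : ℝ) - 1) * ε * (1 - ε) / y + (1 - ε) * xx b ε y) +
        (d : ℝ) * xx b ε y ^ (d + 1) * (1 - xx b ε y) ^ (d - 1) +
        Gd b d ε y * (((b : ℝ) - 1) * ε * (1 - ε) / y + (1 - ε) * xx b ε y) +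
        (d : ℝ) * xx b ε y ^ d * (1 - xx b ε y) +
        (b : ℝ) * ε * (1 - ε) := by
  have hsG := sum_G b d hd ε y
  have hsB : ∑ k ∈ Icc 1 (d - 1), ((d - 1).choose (k - 1) : ℝ) * xx b ε y ^ (1 + k) *
      (1 - xx b ε y) ^ (2 * d - 1 - k) =
      xx b ε y ^ 2 * (1 - xx b ε y) ^ (d - 1) * (1 - xx b ε y ^ (d - 1)) := by
    rw [← sum_range_choose_mul_pow, mul_sum, ← Finset.Ico_add_one_right_eq_Icc,
      sum_Ico_eq_sum_range]
    refine sum_congr rfl fun i hi => ?_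
    have hi' : i < d - 1 := mem_range.mp hi
    rw [show 2 * d - 1 - (1 + i) = (d - 1) + (d - 1 - i) by omega, Nat.add_sub_cancel_left]
    ring
  have hmem : (1 : ℕ) ∈ Icc 1 (d - 1) := mem_Icc.mpr ⟨le_rfl, by omega⟩
  set A := ε * (1 - ε) * ((b : ℝ) - 1) / y ^ 2 - (ε - (1 - ε)) * xx b ε y / y + xx b ε y ^ 2
    with hA
  set B := ε * (1 - ε) * ((b : ℝ) - 1) / y - ε * xx b ε y + xx b ε y ^ 2 with hB
  have hterm : ∀ k ∈ Icc 1 (d - 1), drr b d ε 1 k y =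
      (((b : ℝ) - 1) / b * G b d ε 1 y * A - B) * G b d ε k y
        - d * (((d - 1).choose (k - 1) : ℝ) * xx b ε y ^ (1 + k) *
          (1 - xx b ε y) ^ (2 * d - 1 - k))
        + if k = 1 then xx b ε y * (1 - xx b ε y) ^ (d - 1) +
          (b * ε * (1 - ε) - xx b ε y * (1 - xx b ε y)) - G b d ε 1 y * B else 0 := by
    intro k _
    by_cases hk : k = 1
    · subst hk
      simp [drr, ← hA, ← hB]
      ring
    · simp [drr, hk, Ne.symm hk, ← hA, ← hB]
      ring
  rw [sum_congr rfl hterm, sum_add_distrib, sum_sub_distrib, ← mul_sum, ← mul_sum, hsG, hsB,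
    sum_ite_eq', if_pos hmem]
  have hG : G b d ε 1 y * (1 - xx b ε y) =
      (1 - xx b ε y) ^ (d - 1) * (d * xx b ε y - 1) + (1 - xx b ε y) := by
    rw [show d - 1 = d - 1 - 1 + 1 by omega]
    simp [G]
    ring
  have hGd : Gd b d ε y * xx b ε y = -d * xx b ε y ^ d := by
    obtain ⟨n, rfl⟩ := Nat.exists_eq_add_of_le' hd
    simp only [Gd, show n + 2 - 1 = n + 1 by omega]
    ring
  have hp : xx b ε y ^ (d + 1) = xx b ε y ^ 2 * xx b ε y ^ (d - 1) := by
    rw [← pow_add]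
    congr 1
    omega
  rw [hp]
  simp only [hA, hB]
  linear_combination xx b ε y * hG - (1 - xx b ε y) * hGd
end
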